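/- arXiv:1904.08374 — 3 statements merged into one kernel-verified Lean document; each statement's English description precedes it below -/
import Mathlib

section
/- For all n, E*_n(q) = q^{n(n−1)/2} · E_n(1/q) as an identity of Laurent polynomials (equivalently, the coefficient of q^k in E*_n(q) equals the coefficient of q^{n(n−1)/2 − k} in E_n(q)). -/
attribute [local instance] Classical.propDecidable

def IsAlt {n : ℕ} (σ : Equiv.Perm (Fin n)) : Prop :=
  ∀ i : ℕ, (h : i + 1 < n) → (σ ⟨i + 1, h⟩ < σ ⟨i, Nat.lt_of_succ_lt h⟩ ↔ Even i)

def IsRevAlt {n : ℕ} (σ : Equiv.Perm (Fin n)) : Prop :=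
  ∀ i : ℕ, (h : i + 1 < n) → (σ ⟨i + 1, h⟩ < σ ⟨i, Nat.lt_of_succ_lt h⟩ ↔ Odd i)

def descentSet {n : ℕ} (σ : Equiv.Perm (Fin n)) : Finset ℕ :=
  (Finset.range n).filter fun i => ∃ h : i + 1 < n, σ ⟨i + 1, h⟩ < σ ⟨i, Nat.lt_of_succ_lt h⟩

def maj {n : ℕ} (σ : Equiv.Perm (Fin n)) : ℕ :=
  ∑ i ∈ descentSet σ, (i + 1)

section Foata

variable {α : Type*}

/-- Rotate the head of every block to its end: the letter `a` is carried to the right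
until the next letter satisfying `p`, where it is dropped and that letter is picked up. -/
def carry (p : α → Bool) : α → List α → List α
  | a, [] => [a]
  | a, b :: l => if p b = true then a :: carry p b l else b :: carry p a l

theorem carry_perm (p : α → Bool) (a : α) (l : List α) : (carry p a l).Perm (a :: l) := by
  induction l generalizing a with
  | nil => exact List.Perm.refl _
  | cons b l ih =>
    rw [carry]
    split_ifs
    · exact (ih b).cons a
    · exact ((ih a).cons b).trans (List.Perm.swap a b l)

theorem filter_carry (p : α → Bool) (a : α) (l : List α) (ha : p a = true) :
    (carry p a l).filter p = (a :: l).filter p := by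
  induction l generalizing a with
  | nil => rfl
  | cons b l ih =>
    rw [carry]
    split_ifs with hb
    · simp [ha, ih b hb]
    · simp [hb, ha, ih a ha]

theorem filter_not_carry (p : α → Bool) (a : α) (l : List α) (ha : p a = true) :
    (carry p a l).filter (fun z => !p z) = (a :: l).filter (fun z => !p z) := by
  induction l generalizing a with
  | nil => rfl
  | cons b l ih =>
    rw [carry]
    split_ifs with hb
    · simp [ha, ih b hb]
    · simp [hb, ha, ih a ha]

theorem carry_injective (p : α → Bool) {a a' : α} {l l' : List α} (ha : p a = true)
    (ha' : p a' = true) (h : carry p a l = carry p a' l') : a :: l = a' :: l' := by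
  induction l generalizing a a' l' with
  | nil =>
    have hl := (carry_perm p a' l').length_eq
    rw [← h] at hl
    cases l' with
    | nil => exact h
    | cons => simp [carry] at hl
  | cons b l ih =>
    cases l' with
    | nil =>
      have hl := (carry_perm p a (b :: l)).length_eq
      rw [h] at hl
      simp [carry] at hl
    | cons b' l' =>
      rw [carry, carry] at h
      split_ifs at h with hb hb' hb'
      · obtain ⟨h1, h2⟩ := List.cons.inj h
        rw [h1, ih hb hb' h2]
      · obtain ⟨h1, -⟩ := List.cons.inj h
        exact absurd (h1 ▸ ha) hb'
      · obtain ⟨h1, -⟩ := List.cons.inj h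
        exact absurd (h1 ▸ ha') hb
      · obtain ⟨h1, h2⟩ := List.cons.inj h
        obtain ⟨h3, h4⟩ := List.cons.inj (ih ha ha' h2)
        rw [h1, h3, h4]

theorem carry_getLast (p : α → Bool) (a : α) (l : List α) (ha : p a = true) :
    ∃ z, (carry p a l).getLast? = some z ∧ p z = true := by
  induction l generalizing a with
  | nil => exact ⟨a, rfl, ha⟩
  | cons b l ih =>
    rw [carry]
    split_ifs with hb
    · obtain ⟨z, hz, hpz⟩ := ih b hb
      exact ⟨z, by simp [List.getLast?_cons, hz], hpz⟩
    · obtain ⟨z, hz, hpz⟩ := ih a ha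
      exact ⟨z, by simp [List.getLast?_cons, hz], hpz⟩

theorem filter_eq_filter_of_imp {p q : α → Bool} {l l' : List α} (h : l.filter p = l'.filter p)
    (hl : ∀ z ∈ l, q z = true → p z = true) (hl' : ∀ z ∈ l', q z = true → p z = true) :
    l.filter q = l'.filter q := by
  have key : ∀ m : List α, (∀ z ∈ m, q z = true → p z = true) →
      m.filter q = (m.filter p).filter q := by
    intro m hm
    rw [List.filter_filter]
    refine List.filter_congr fun z hz => ?_
    have := hm z hz
    cases hq : q z <;> simp_all
  rw [key l hl, key l' hl', h]

theorem pair_sublist_reverse_iff (a b : α) (l : List α) :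
    [a, b].Sublist l.reverse ↔ [b, a].Sublist l := by
  rw [← List.reverse_sublist]
  simp

variable [LinearOrder α]

/-- The step of Foata's second fundamental transformation attached to the letter `x`, acting on
words that are read from right to left. -/
noncomputable def foataStep (x : α) : List α → List α
  | [] => []
  | a :: l => if x < a then carry (fun z => decide (x < z)) a l
      else carry (fun z => !decide (x < z)) a l

/-- Foata's second fundamental transformation, acting on words that are read from right to left. -/
noncomputable def foata : List α → List α
  | [] => []
  | x :: l => x :: foataStep x (foata l)

/-- The number of inversions of the reversal of a word. -/
noncomputable def revInv : List α → ℕ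
  | [] => 0
  | x :: l => l.countP (fun z => decide (x < z)) + revInv l

/-- The major index of the reversal of a word. -/
noncomputable def revMaj : List α → ℕ
  | [] => 0
  | x :: l => (if ∃ y ∈ l.head?, x < y then l.length else 0) + revMaj l

theorem foataStep_perm (x : α) (l : List α) : (foataStep x l).Perm l := by
  cases l with
  | nil => exact List.Perm.refl _
  | cons a l =>
    rw [foataStep]
    split_ifs <;> exact carry_perm _ _ _

theorem foata_perm (l : List α) : (foata l).Perm l := by
  induction l with
  | nil => exact List.Perm.refl _
  | cons x l ih => exact ((foataStep_perm x _).trans ih).cons x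

theorem foataStep_injective (x : α) : Function.Injective (foataStep x) := by
  intro l l' h
  have hl : l.length = l'.length := by
    rw [← (foataStep_perm x l).length_eq, h, (foataStep_perm x l').length_eq]
  match l, l', hl with
  | [], [], _ => rfl
  | a :: l, a' :: l', _ =>
    rw [foataStep, foataStep] at h
    split_ifs at h with ha ha' ha'
    · exact carry_injective _ (by simpa using ha) (by simpa using ha') h
    · obtain ⟨z, hz, h1⟩ := carry_getLast (fun z => decide (x < z)) a l (by simpa using ha)
      obtain ⟨w, hw, h2⟩ := carry_getLast (fun z => !decide (x < z)) a' l' (by simpa using ha')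
      rw [h, hw] at hz
      cases hz
      simp [h1] at h2
    · obtain ⟨z, hz, h1⟩ := carry_getLast (fun z => decide (x < z)) a' l' (by simpa using ha')
      obtain ⟨w, hw, h2⟩ := carry_getLast (fun z => !decide (x < z)) a l (by simpa using ha)
      rw [← h, hw] at hz
      cases hz
      simp_all
    · exact carry_injective _ (by simpa using ha) (by simpa using ha') h

theorem foata_injective : Function.Injective (foata : List α → List α) := by
  intro l
  induction l with
  | nil =>
    intro l' h
    have := (foata_perm l').length_eq
    rw [← h] at this
    exact (List.eq_nil_of_length_eq_zero this.symm).symm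
  | cons x l ih =>
    intro l' h
    cases l' with
    | nil => simp [foata] at h
    | cons x' l' =>
      obtain ⟨rfl, h2⟩ := List.cons.inj h
      rw [ih (foataStep_injective x h2)]

theorem revInv_carry_of_lt (x a : α) (l : List α) (ha : x < a) :
    revInv (carry (fun z => decide (x < z)) a l) =
      revInv (a :: l) + l.countP (fun z => !decide (x < z)) := by
  induction l generalizing a with
  | nil => simp [carry]
  | cons b l ih =>
    rw [carry]
    by_cases hb : x < b
    · have hp := (carry_perm (fun z => decide (x < z)) b l).countP_eq (fun z => decide (a < z))
      simp only [hb, decide_true, if_true, revInv, ih b hb, hp, List.countP_cons]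
      simp
      omega
    · have hba : b < a := (not_lt.1 hb).trans_lt ha
      have hp := (carry_perm (fun z => decide (x < z)) a l).countP_eq (fun z => decide (b < z))
      simp only [hb, decide_false, revInv, List.countP_cons, hba.not_gt]
      simp [revInv, ih a ha, hp, hba]
      omega

theorem revInv_carry_of_le (x a : α) (l : List α) (ha : a ≤ x) :
    revInv (carry (fun z => !decide (x < z)) a l) + l.countP (fun z => decide (x < z)) =
      revInv (a :: l) := by
  induction l generalizing a with
  | nil => simp [carry]
  | cons b l ih =>
    rw [carry]
    by_cases hb : x < b
    · have hab : a < b := ha.trans_lt hb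
      have hp := (carry_perm (fun z => !decide (x < z)) a l).countP_eq (fun z => decide (b < z))
      have := ih a ha
      simp [revInv, hp, hb, hab, hab.not_gt] at this ⊢
      omega
    · have hp := (carry_perm (fun z => !decide (x < z)) b l).countP_eq (fun z => decide (a < z))
      have := ih b (not_lt.1 hb)
      simp [revInv, hp, hb, List.countP_cons] at this ⊢
      omega

theorem length_eq_countP_lt_add (x : α) (l : List α) :
    l.length = l.countP (fun z => decide (x < z)) + l.countP (fun z => !decide (x < z)) := by
  exact (List.length_eq_countP_add_countP (fun z => decide (x < z))).trans
    (congrArg _ (List.countP_congr fun z _ => by simp))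

theorem revInv_foataStep (x : α) (l : List α) :
    revInv (foataStep x l) + l.countP (fun z => decide (x < z)) =
      revInv l + if ∃ y ∈ l.head?, x < y then l.length else 0 := by
  cases l with
  | nil => simp [foataStep]
  | cons a l =>
    rw [foataStep]
    by_cases ha : x < a
    · have hc := length_eq_countP_lt_add x l
      have := revInv_carry_of_lt x a l ha
      simp only [ha, if_true, List.countP_cons, List.head?_cons, Option.mem_some_iff,
        exists_eq_left', List.length_cons, decide_true, this]
      omega
    · have := revInv_carry_of_le x a l (not_lt.1 ha)
      simp [ha] at this ⊢
      omega

theorem head?_foata (l : List α) : (foata l).head? = l.head? := by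
  cases l <;> rfl

theorem revInv_foata (l : List α) : revInv (foata l) = revMaj l := by
  induction l with
  | nil => rfl
  | cons x l ih =>
    have h := revInv_foataStep x (foata l)
    rw [head?_foata, ih, (foata_perm l).length_eq] at h
    rw [foata, revInv, revMaj, (foataStep_perm x _).countP_eq]
    omega

theorem filter_lt_foataStep (x : α) (l : List α) :
    (foataStep x l).filter (fun z => decide (x < z)) = l.filter (fun z => decide (x < z)) := by
  cases l with
  | nil => rfl
  | cons a l =>
    rw [foataStep]
    split_ifs with ha
    · exact filter_carry _ _ _ (by simpa using ha)
    · simpa using filter_not_carry (fun z => !decide (x < z)) a l (by simpa using ha)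

theorem filter_not_lt_foataStep (x : α) (l : List α) :
    (foataStep x l).filter (fun z => !decide (x < z)) = l.filter (fun z => !decide (x < z)) := by
  cases l with
  | nil => rfl
  | cons a l =>
    rw [foataStep]
    split_ifs with ha
    · exact filter_not_carry _ _ _ (by simpa using ha)
    · exact filter_carry _ _ _ (by simpa using ha)

theorem filter_pair_foata {a b : α} (hab : a ⋖ b) {l : List α} (hl : l.Nodup) :
    (foata l).filter (fun z => decide (z = a ∨ z = b)) =
      l.filter (fun z => decide (z = a ∨ z = b)) := by
  induction l with
  | nil => rfl
  | cons x l ih =>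
    obtain ⟨hx, hl⟩ := List.nodup_cons.1 hl
    have hne : ∀ z ∈ foata l, z ≠ x := fun z hz h => hx (h ▸ (foata_perm l).mem_iff.1 hz)
    have hne' : ∀ z ∈ foataStep x (foata l), z ≠ x := fun z hz =>
      hne z ((foataStep_perm x _).mem_iff.1 hz)
    have key : (foataStep x (foata l)).filter (fun z => decide (z = a ∨ z = b)) =
        (foata l).filter (fun z => decide (z = a ∨ z = b)) := by
      rcases le_or_gt b x with hbx | hbx
      · have : ∀ z, (z = a ∨ z = b) → ¬ x < z := by
          rintro z (rfl | rfl)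
          · exact (hab.lt.le.trans hbx).not_gt
          · exact hbx.not_gt
        exact filter_eq_filter_of_imp (filter_not_lt_foataStep x _)
          (fun z _ hz => by simpa using this z (by simpa using hz))
          (fun z _ hz => by simpa using this z (by simpa using hz))
      · have hxa : x ≤ a := not_lt.1 fun h => hab.2 h hbx
        have : ∀ z, z ≠ x → (z = a ∨ z = b) → x < z := by
          rintro z hz (rfl | rfl)
          · exact lt_of_le_of_ne hxa hz.symm
          · exact hbx
        exact filter_eq_filter_of_imp (filter_lt_foataStep x _)
          (fun z hm hz => by simpa using this z (hne' z hm) (by simpa using hz))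
          (fun z hm hz => by simpa using this z (hne z hm) (by simpa using hz))
    rw [foata, List.filter_cons, List.filter_cons, key, ih hl]

theorem pair_sublist_foata_iff {a b : α} (hab : a ⋖ b) {l : List α} (hl : l.Nodup) :
    [a, b].Sublist (foata l) ↔ [a, b].Sublist l := by
  have key : ∀ m : List α, [a, b].Sublist m ↔
      [a, b].Sublist (m.filter (fun z => decide (z = a ∨ z = b))) := fun m =>
    ⟨fun h => by simpa using h.filter (fun z => decide (z = a ∨ z = b)),
      fun h => h.trans List.filter_sublist⟩
  rw [key, filter_pair_foata hab hl, ← key]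

theorem revInv_append_singleton (l : List α) (x : α) :
    revInv (l ++ [x]) = revInv l + l.countP (fun z => decide (z < x)) := by
  induction l with
  | nil => simp [revInv]
  | cons y l ih =>
    simp [revInv, ih, List.countP_append, List.countP_cons]
    omega

theorem revInv_reverse_add {l : List α} (hl : l.Nodup) :
    revInv l.reverse + revInv l = l.length.choose 2 := by
  induction l with
  | nil => rfl
  | cons x l ih =>
    obtain ⟨hx, hl⟩ := List.nodup_cons.1 hl
    have hc := length_eq_countP_lt_add x l
    have hc' : l.countP (fun z => decide (z < x)) = l.countP (fun z => !decide (x < z)) := by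
      refine List.countP_congr fun z hz => ?_
      have : z ≠ x := fun h => hx (h ▸ hz)
      simpa using this.le_iff_lt.symm
    have h := ih hl
    have hchoose : (l.length + 1).choose 2 = l.length + l.length.choose 2 :=
      (Nat.choose_succ_succ' _ 1).trans (by rw [Nat.choose_one_right])
    simp only [List.reverse_cons, revInv_append_singleton, List.countP_reverse, revInv,
      List.length_cons, hchoose]
    omega

theorem revMaj_reverse_ofFn {n : ℕ} (f : Fin n → α) :
    revMaj (List.ofFn f).reverse = ∑ i ∈ Finset.range n,
      if ∃ h : i + 1 < n, f ⟨i + 1, h⟩ < f ⟨i, Nat.lt_of_succ_lt h⟩ then i + 1 else 0 := by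
  induction n with
  | zero => simp [revMaj]
  | succ n ih =>
    rw [List.ofFn_succ', List.concat_eq_append, List.reverse_append, List.reverse_singleton,
      List.singleton_append, revMaj, ih]
    cases n with
    | zero => simp
    | succ m =>
      have hhead : (List.ofFn fun i : Fin (m + 1) => f i.castSucc).reverse.head? =
          some (f ⟨m, by omega⟩) := by
        rw [List.ofFn_succ', List.concat_eq_append, List.reverse_append]
        rfl
      rw [hhead, Finset.sum_range_succ _ (m + 1), Finset.sum_range_succ _ m,
        Finset.sum_range_succ _ m]
      have hsum : ∀ i ∈ Finset.range m,
          (if ∃ h : i + 1 < m + 1, f (Fin.castSucc ⟨i + 1, h⟩) <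
            f (Fin.castSucc ⟨i, Nat.lt_of_succ_lt h⟩) then i + 1 else 0) =
          if ∃ h : i + 1 < m + 1 + 1, f ⟨i + 1, h⟩ < f ⟨i, Nat.lt_of_succ_lt h⟩
            then i + 1 else 0 := by
        intro i hi
        have := Finset.mem_range.1 hi
        refine if_congr ⟨fun ⟨h, h'⟩ => ⟨by omega, h'⟩, fun ⟨h, h'⟩ => ⟨by omega, h'⟩⟩ rfl rfl
      rw [Finset.sum_congr rfl hsum]
      simp [Fin.last]
      omega

end Foata

theorem revMaj_reverse_ofFn_perm {n : ℕ} (τ : Equiv.Perm (Fin n)) :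
    revMaj (List.ofFn τ).reverse = maj τ := by
  rw [revMaj_reverse_ofFn, maj, descentSet, Finset.sum_filter]
  exact Finset.sum_congr rfl fun i _ => by congr

theorem pair_sublist_ofFn_perm_iff {n : ℕ} (τ : Equiv.Perm (Fin n)) (a b : Fin n) :
    [a, b].Sublist (List.ofFn τ) ↔ τ⁻¹ a < τ⁻¹ b := by
  constructor
  · have h : (List.ofFn τ).Pairwise fun a b => τ⁻¹ a < τ⁻¹ b :=
      List.pairwise_ofFn.2 fun i j hij => by simpa using hij
    exact fun h' => List.pairwise_iff_forall_sublist.1 h h'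
  · intro h
    by_contra hn
    have hp : (List.ofFn τ).Pairwise fun c d => ¬ (c = a ∧ d = b) := by
      refine List.pairwise_iff_forall_sublist.2 ?_
      rintro c d hcd ⟨rfl, rfl⟩
      exact hn hcd
    exact List.pairwise_ofFn.1 hp h ⟨by simp, by simp⟩

/-- The permutations of `Fin n`, as words. -/
def permWords (n : ℕ) : Finset (List (Fin n)) :=
  (Finset.univ : Finset (Equiv.Perm (Fin n))).image fun τ : Equiv.Perm (Fin n) => List.ofFn τ

theorem mem_permWords {n : ℕ} {l : List (Fin n)} :
    l ∈ permWords n ↔ l.Nodup ∧ l.length = n := by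
  simp only [permWords, Finset.mem_image, Finset.mem_univ, true_and]
  constructor
  · rintro ⟨τ, rfl⟩
    exact ⟨List.nodup_ofFn.2 τ.injective, List.length_ofFn⟩
  · rintro ⟨hl, hn⟩
    exact ⟨Equiv.ofBijective (fun i => l.get (Fin.cast hn.symm i))
      (Finite.injective_iff_bijective.1 (hl.injective_get.comp (Fin.cast_injective _))),
      List.ext_getElem (by simp [hn]) (by simp)⟩

theorem foata_mem_permWords {n : ℕ} {l : List (Fin n)} (hl : l ∈ permWords n) :
    foata l ∈ permWords n := by
  rw [mem_permWords] at hl ⊢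
  exact ⟨(foata_perm l).nodup_iff.2 hl.1, (foata_perm l).length_eq.trans hl.2⟩

theorem reverse_mem_permWords {n : ℕ} {l : List (Fin n)} (hl : l ∈ permWords n) :
    l.reverse ∈ permWords n := by
  rw [mem_permWords] at hl ⊢
  simpa using hl

/-- The values `i` such that `i` precedes `i + 1` in the word are those satisfying `P`. -/
def HasPattern {n : ℕ} (P : ℕ → Prop) (l : List (Fin n)) : Prop :=
  ∀ i : ℕ, (h : i + 1 < n) → ([⟨i, Nat.lt_of_succ_lt h⟩, ⟨i + 1, h⟩].Sublist l ↔ P i)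

theorem hasPattern_foata {n : ℕ} {P : ℕ → Prop} {l : List (Fin n)} (hl : l.Nodup) :
    HasPattern P (foata l) ↔ HasPattern P l := by
  refine forall₂_congr fun i h => iff_congr (pair_sublist_foata_iff ?_ hl) Iff.rfl
  refine ⟨by simp [Fin.lt_def], fun c h1 h2 => ?_⟩
  simp only [Fin.lt_def] at h1 h2
  omega

theorem hasPattern_reverse_ofFn {n : ℕ} {P : ℕ → Prop} (τ : Equiv.Perm (Fin n)) :
    HasPattern P (List.ofFn τ).reverse ↔ ∀ i : ℕ, (h : i + 1 < n) →
      (τ⁻¹ ⟨i + 1, h⟩ < τ⁻¹ ⟨i, Nat.lt_of_succ_lt h⟩ ↔ P i) := by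
  simp only [HasPattern, pair_sublist_reverse_iff, pair_sublist_ofFn_perm_iff]

theorem hasPattern_reverse {n : ℕ} {P : ℕ → Prop} {l : List (Fin n)} (hl : l ∈ permWords n) :
    HasPattern P l.reverse ↔ HasPattern (fun i => ¬ P i) l := by
  obtain ⟨τ, -, rfl⟩ := Finset.mem_image.1 hl
  refine forall₂_congr fun i h => ?_
  have hne : τ⁻¹ ⟨i, Nat.lt_of_succ_lt h⟩ ≠ τ⁻¹ ⟨i + 1, h⟩ := by simp
  have hlt := hne.le_iff_lt
  rw [← not_lt] at hlt
  rw [pair_sublist_reverse_iff, pair_sublist_ofFn_perm_iff, pair_sublist_ofFn_perm_iff, ← hlt,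
    not_iff_not]

theorem card_hasPattern_revMaj_eq_revInv (n k : ℕ) (P : ℕ → Prop) :
    ((permWords n).filter fun l => HasPattern P l ∧ revMaj l = k).card =
      ((permWords n).filter fun l => HasPattern P l ∧ revInv l = k).card := by
  have himage : (permWords n).image foata = permWords n :=
    Finset.eq_of_subset_of_card_le
      (Finset.image_subset_iff.2 fun _ => foata_mem_permWords)
      (Finset.card_image_of_injective _ foata_injective).ge
  conv_rhs => rw [← himage, Finset.filter_image, Finset.card_image_of_injective _ foata_injective]
  congr 1
  refine Finset.filter_congr fun l hl => ?_
  rw [hasPattern_foata (mem_permWords.1 hl).1, revInv_foata]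

theorem card_hasPattern_revInv_compl {n k : ℕ} (hk : k ≤ n * (n - 1) / 2) (P : ℕ → Prop) :
    ((permWords n).filter fun l => HasPattern P l ∧ revInv l = k).card =
      ((permWords n).filter fun l =>
        HasPattern (fun i => ¬ P i) l ∧ revInv l = n * (n - 1) / 2 - k).card := by
  have hinv : ∀ l ∈ permWords n, revInv l.reverse + revInv l = n * (n - 1) / 2 := by
    intro l hl
    obtain ⟨h1, h2⟩ := mem_permWords.1 hl
    rw [revInv_reverse_add h1, h2, Nat.choose_two_right]
  refine Finset.card_bij' (fun l _ => l.reverse) (fun l _ => l.reverse) ?_ ?_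
    (fun _ _ => List.reverse_reverse _) (fun _ _ => List.reverse_reverse _)
  · intro l hl
    obtain ⟨h1, h2, h3⟩ := Finset.mem_filter.1 hl
    have := hinv l h1
    refine Finset.mem_filter.2 ⟨reverse_mem_permWords h1, ?_, by omega⟩
    simpa only [hasPattern_reverse h1, not_not] using h2
  · intro l hl
    obtain ⟨h1, h2, h3⟩ := Finset.mem_filter.1 hl
    have := hinv l h1
    exact Finset.mem_filter.2 ⟨reverse_mem_permWords h1, (hasPattern_reverse h1).2 h2, by omega⟩

theorem card_perm_eq_card_permWords (n k : ℕ) (P : ℕ → Prop) :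
    (Finset.univ.filter fun σ : Equiv.Perm (Fin n) => (∀ i : ℕ, (h : i + 1 < n) →
      (σ ⟨i + 1, h⟩ < σ ⟨i, Nat.lt_of_succ_lt h⟩ ↔ P i)) ∧ maj σ⁻¹ = k).card =
      ((permWords n).filter fun l => HasPattern P l ∧ revMaj l = k).card := by
  refine Finset.card_bij (fun σ _ => (List.ofFn ⇑σ⁻¹).reverse) ?_ ?_ ?_
  · intro σ hσ
    obtain ⟨-, h1, h2⟩ := Finset.mem_filter.1 hσ
    refine Finset.mem_filter.2 ⟨reverse_mem_permWords
      (Finset.mem_image_of_mem _ (Finset.mem_univ _)), ?_, ?_⟩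
    · rw [hasPattern_reverse_ofFn, inv_inv]
      exact h1
    · rw [revMaj_reverse_ofFn_perm, h2]
  · intro σ _ σ' _ h
    exact inv_injective (DFunLike.coe_injective (List.ofFn_injective (List.reverse_injective h)))
  · intro l hl
    obtain ⟨h1, h2, h3⟩ := Finset.mem_filter.1 hl
    obtain ⟨τ, -, hτ⟩ := Finset.mem_image.1 (reverse_mem_permWords h1)
    have hl' : l = (List.ofFn τ).reverse := by
      rw [hτ, List.reverse_reverse]
    subst hl'
    refine ⟨τ⁻¹, Finset.mem_filter.2 ⟨Finset.mem_univ _, ?_, ?_⟩, by rw [inv_inv]⟩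
    · exact (hasPattern_reverse_ofFn τ).1 h2
    · rw [inv_inv, ← revMaj_reverse_ofFn_perm, h3]

/-- The coefficient of `q^k` in `E*_n(q)` equals the coefficient of `q^{n(n-1)/2 - k}`
in `E_n(q)`, where `E_n(q) = Σ_{σ ∈ RevAlt_n} q^{maj σ⁻¹}` and
`E*_n(q) = Σ_{σ ∈ Alt_n} q^{maj σ⁻¹}`. -/
theorem EStar_eq_reversed_E (n k : ℕ) (hk : k ≤ n * (n - 1) / 2) :
    (Finset.univ.filter fun σ : Equiv.Perm (Fin n) => IsAlt σ ∧ maj σ⁻¹ = k).card =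
    (Finset.univ.filter fun σ : Equiv.Perm (Fin n) =>
      IsRevAlt σ ∧ maj σ⁻¹ = n * (n - 1) / 2 - k).card := by
  convert (card_perm_eq_card_permWords n k Even).trans
    ((card_hasPattern_revMaj_eq_revInv n k Even).trans
      ((card_hasPattern_revInv_compl hk Even).trans
        ((card_hasPattern_revMaj_eq_revInv n _ _).symm.trans
          (card_perm_eq_card_permWords n _ _).symm))) using 4
  · exact Iff.rfl
  · simp only [IsRevAlt, Nat.not_even_iff_odd]
end

section
/- For every natural number n, Σ over all Dyck paths (h₀,h₁,…,h_{2n}) of length 2n of (2n+1)! / ∏_{i=0}^{2n} (2h_i + 1) equals the Euler number E_{2n+1}, the number of alternating permutations of {1,...,2n+1}. -/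
attribute [local instance] Classical.propDecidable

/-- The height after `i` steps of the lattice path with step sequence `s`
(`true` = up-step `(1,1)`, `false` = down-step `(1,-1)`). -/
def pathHeight {m : ℕ} (s : Fin m → Bool) (i : ℕ) : ℤ :=
  ∑ j : Fin m, if (j : ℕ) < i then (if s j then (1 : ℤ) else -1) else 0

/-- Dyck paths of length `2n`, encoded by their step sequences: all partial heights are
nonnegative and the final height is `0`. -/
def dyckPaths (n : ℕ) : Finset (Fin (2 * n) → Bool) :=
  Finset.univ.filter fun s =>
    (∀ i ≤ 2 * n, 0 ≤ pathHeight s i) ∧ pathHeight s (2 * n) = 0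

open Finset

section WeightedPaths

lemma pathHeight_zero {m : ℕ} (s : Fin m → Bool) : pathHeight s 0 = 0 := by
  simp [pathHeight]

lemma pathHeight_cons_succ {m : ℕ} (b : Bool) (s : Fin m → Bool) (i : ℕ) :
    pathHeight (Fin.cons b s : Fin (m + 1) → Bool) (i + 1) =
      (if b then 1 else -1) + pathHeight s i := by
  simp [pathHeight, Fin.sum_univ_succ]

/-- The weight of all nonnegative paths of length `m` from height `h` to height `0`, each
vertex at height `x` contributing a factor `1 / (2x + 1)`. -/
noncomputable def pathWeight (m : ℕ) (h : ℤ) : ℚ :=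
  ∑ s : Fin m → Bool,
    if (∀ i ≤ m, 0 ≤ h + pathHeight s i) ∧ h + pathHeight s m = 0 then
      (∏ i ∈ range (m + 1), ((2 * (h + pathHeight s i) + 1 : ℤ) : ℚ))⁻¹ else 0

lemma pathWeight_zero (h : ℤ) : pathWeight 0 h = if h = 0 then 1 else 0 := by
  by_cases hh : h = 0 <;> simp [pathWeight, pathHeight_zero, hh]

lemma pathWeight_of_neg (m : ℕ) {h : ℤ} (hh : h < 0) : pathWeight m h = 0 := by
  refine sum_eq_zero fun s _ => if_neg ?_
  rintro ⟨h0, -⟩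
  have := h0 0 (Nat.zero_le _)
  rw [pathHeight_zero] at this
  omega

lemma forall_le_add_one_iff {m : ℕ} {p : ℕ → Prop} :
    (∀ i ≤ m + 1, p i) ↔ p 0 ∧ ∀ i ≤ m, p (i + 1) := by
  refine ⟨fun h => ⟨h 0 (Nat.zero_le _), fun i hi => h _ (by omega)⟩, fun h i hi => ?_⟩
  cases i with
  | zero => exact h.1
  | succ i => exact h.2 i (by omega)

lemma pathWeight_succ (m : ℕ) {h : ℤ} (hh : 0 ≤ h) :
    pathWeight (m + 1) h =
      (2 * h + 1 : ℚ)⁻¹ * (pathWeight m (h + 1) + pathWeight m (h - 1)) := by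
  unfold pathWeight
  rw [← (Fin.consEquiv fun _ : Fin (m + 1) => Bool).sum_comp, Fintype.sum_prod_type,
    Fintype.sum_bool, mul_add, mul_sum, mul_sum]
  congr 1 <;>
  · refine sum_congr rfl fun s _ => ?_
    have hcons : ∀ (b : Bool) (i : ℕ),
        pathHeight ((Fin.consEquiv fun _ : Fin (m + 1) => Bool) (b, s)) (i + 1) =
          (if b then 1 else -1) + pathHeight s i := fun b i => pathHeight_cons_succ b s i
    rw [prod_range_succ']
    simp only [forall_le_add_one_iff, hcons, pathHeight_zero, add_zero, hh,
      true_and, mul_ite, mul_zero, ← add_assoc, mul_inv, if_true, Bool.false_eq_true, if_false,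
      sub_eq_add_neg]
    refine if_congr Iff.rfl ?_ rfl
    push_cast
    ring

lemma pathWeight_of_lt (m : ℕ) {h : ℤ} (hh : m < h) : pathWeight m h = 0 := by
  induction m generalizing h with
  | zero => rw [pathWeight_zero, if_neg (by omega)]
  | succ m ih =>
    push_cast at hh
    rw [pathWeight_succ m (by omega), ih (by omega), ih (by omega)]
    simp

/-- The coefficients of the power series of the spherical Bessel functions. -/
def besselCoeff (h k : ℕ) : ℚ :=
  (-1) ^ k * 2 ^ h * (h + k).factorial / (k.factorial * (2 * h + 2 * k + 1).factorial)

lemma besselCoeff_zero_left (k : ℕ) : besselCoeff 0 k = (-1) ^ k / (2 * k + 1).factorial := by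
  have := Nat.cast_ne_zero (R := ℚ) |>.2 k.factorial_ne_zero
  simp only [besselCoeff, mul_zero, zero_add, pow_zero, mul_one]
  field_simp

lemma besselCoeff_zero_succ (k : ℕ) :
    besselCoeff 0 (k + 1) = (-1) ^ (k + 1) / (2 * (k + 1)).factorial + besselCoeff 1 k := by
  have h1 := Nat.cast_ne_zero (R := ℚ) |>.2 k.factorial_ne_zero
  have h2 := Nat.cast_ne_zero (R := ℚ) |>.2 (2 * k + 2).factorial_ne_zero
  rw [besselCoeff_zero_left, besselCoeff, show 2 * (k + 1) + 1 = (2 * k + 2) + 1 by ring,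
    show 2 * 1 + 2 * k + 1 = (2 * k + 2) + 1 by ring, show 2 * (k + 1) = 2 * k + 2 by ring,
    show 1 + k = k + 1 by ring, Nat.factorial_succ (2 * k + 2), Nat.factorial_succ k]
  push_cast
  field_simp
  ring

lemma besselCoeff_succ_zero (h : ℕ) :
    (2 * h + 3) * besselCoeff (h + 1) 0 = besselCoeff h 0 := by
  have h2 := Nat.cast_ne_zero (R := ℚ) |>.2 (2 * h + 1).factorial_ne_zero
  simp only [besselCoeff, add_zero, mul_zero]
  rw [show 2 * (h + 1) + 1 = (2 * h + 1) + 1 + 1 by ring, Nat.factorial_succ (2 * h + 1 + 1),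
    Nat.factorial_succ (2 * h + 1), Nat.factorial_succ h]
  push_cast
  field_simp
  ring

lemma besselCoeff_succ_succ (h k : ℕ) :
    (2 * h + 3) * besselCoeff (h + 1) (k + 1) =
      besselCoeff h (k + 1) + besselCoeff (h + 2) k := by
  have h1 := Nat.cast_ne_zero (R := ℚ) |>.2 k.factorial_ne_zero
  have h2 := Nat.cast_ne_zero (R := ℚ) |>.2 (2 * h + 2 * k + 3).factorial_ne_zero
  have h3 := Nat.cast_ne_zero (R := ℚ) |>.2 (h + k + 1).factorial_ne_zero
  simp only [besselCoeff]
  rw [show 2 * (h + 1) + 2 * (k + 1) + 1 = (2 * h + 2 * k + 3) + 1 + 1 by ring,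
    show 2 * h + 2 * (k + 1) + 1 = 2 * h + 2 * k + 3 by ring,
    show 2 * (h + 2) + 2 * k + 1 = (2 * h + 2 * k + 3) + 1 + 1 by ring,
    show h + 1 + (k + 1) = (h + k + 1) + 1 by ring,
    show h + (k + 1) = h + k + 1 by ring, show h + 2 + k = (h + k + 1) + 1 by ring,
    Nat.factorial_succ (2 * h + 2 * k + 3 + 1),
    Nat.factorial_succ (2 * h + 2 * k + 3), Nat.factorial_succ (h + k + 1), Nat.factorial_succ k]
  push_cast
  field_simp
  ring

/-- The coefficients of the product of the generating function of `pathWeight` with the cosine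
series. -/
noncomputable def cosConv (h k : ℕ) : ℚ :=
  ∑ i ∈ range (k + 1), (-1) ^ i / (2 * i).factorial * pathWeight (h + 2 * (k - i)) h

lemma cosConv_zero_zero : cosConv 0 0 = 1 := by
  simp [cosConv, pathWeight_zero]

lemma cosConv_zero_succ (k : ℕ) :
    cosConv 0 (k + 1) = (-1) ^ (k + 1) / (2 * (k + 1)).factorial + cosConv 1 k := by
  rw [cosConv, sum_range_succ, add_comm]
  congr 1
  · simp [pathWeight_zero]
  · refine sum_congr rfl fun i hi => ?_
    have hi' : i ≤ k := by simpa [Nat.lt_succ_iff] using hi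
    congr 1
    rw [show 0 + 2 * (k + 1 - i) = 1 + 2 * (k - i) + 1 by omega, pathWeight_succ _ (by simp),
      pathWeight_of_neg _ (h := ((0 : ℕ) : ℤ) - 1) (by simp)]
    simp

lemma cosConv_succ_zero (h : ℕ) : (2 * h + 3) * cosConv (h + 1) 0 = cosConv h 0 := by
  have h3 : (2 * h + 3 : ℚ) ≠ 0 := by positivity
  simp only [cosConv, zero_add, sum_range_one]
  simp only [mul_zero, add_zero, Nat.sub_self]
  rw [pathWeight_succ _ (by positivity), pathWeight_of_lt h (by push_cast; omega)]
  push_cast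
  rw [add_sub_cancel_right, show (2 * ((h : ℚ) + 1) + 1) = 2 * h + 3 by ring]
  field_simp
  simp

lemma cosConv_succ_succ (h k : ℕ) :
    (2 * h + 3) * cosConv (h + 1) (k + 1) = cosConv h (k + 1) + cosConv (h + 2) k := by
  have h3 : (2 * h + 3 : ℚ) ≠ 0 := by positivity
  have key : ∀ m : ℕ, (2 * h + 3) * pathWeight (m + 1) ((h + 1 : ℕ) : ℤ) =
      pathWeight m h + pathWeight m ((h + 2 : ℕ) : ℤ) := by
    intro m
    rw [pathWeight_succ _ (by positivity)]
    push_cast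
    rw [add_sub_cancel_right, show (2 * ((h : ℚ) + 1) + 1) = 2 * h + 3 by ring,
      show (h : ℤ) + 1 + 1 = h + 2 by ring]
    field_simp
    ring
  have hlast : cosConv (h + 2) k = ∑ i ∈ range (k + 1 + 1),
      (-1) ^ i / (2 * i).factorial * pathWeight (h + 2 * (k + 1 - i)) ((h + 2 : ℕ) : ℤ) := by
    rw [sum_range_succ, pathWeight_of_lt (h + 2 * (k + 1 - (k + 1))) (by push_cast; omega),
      mul_zero, add_zero]
    refine sum_congr rfl fun i hi => ?_
    have hi' : i ≤ k := by simpa [Nat.lt_succ_iff] using hi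
    rw [show h + 2 + 2 * (k - i) = h + 2 * (k + 1 - i) by omega]
  rw [hlast, cosConv, cosConv, ← sum_add_distrib, mul_sum]
  refine sum_congr rfl fun i _ => ?_
  rw [← mul_add, ← key, show h + 1 + 2 * (k + 1 - i) = h + 2 * (k + 1 - i) + 1 by ring]
  ring

lemma cosConv_eq_besselCoeff (h k : ℕ) : cosConv h k = besselCoeff h k := by
  induction k generalizing h with
  | zero =>
    induction h with
    | zero => simp [cosConv_zero_zero, besselCoeff]
    | succ h ih =>
      have h3 : (2 * h + 3 : ℚ) ≠ 0 := by positivity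
      apply mul_left_cancel₀ h3
      rw [cosConv_succ_zero, besselCoeff_succ_zero, ih]
  | succ k ihk =>
    induction h with
    | zero => rw [cosConv_zero_succ, besselCoeff_zero_succ, ihk]
    | succ h ih =>
      have h3 : (2 * h + 3 : ℚ) ≠ 0 := by positivity
      apply mul_left_cancel₀ h3
      rw [cosConv_succ_succ, besselCoeff_succ_succ, ih, ihk]

lemma sum_cos_mul_pathWeight (n : ℕ) :
    ∑ i ∈ range (n + 1), (-1) ^ i / (2 * i).factorial * pathWeight (2 * (n - i)) 0 =
      (-1) ^ n / (2 * n + 1).factorial := by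
  rw [← besselCoeff_zero_left, ← cosConv_eq_besselCoeff]
  simp [cosConv]

end WeightedPaths

section Entringer

/-- The integer triangle of the boustrophedon recursion, extended to all `k` by the polynomial
continuation in `k`; for even `t` the row increases from `0`, for odd `t` it decreases to `0`. -/
def entringer : ℕ → ℕ → ℕ → ℤ
  | 0, _, _ => 1
  | n + 1, t, k =>
    if Even t then ∑ j ∈ range k, entringer n (t + 1) j
    else ∑ j ∈ range (n + 1), entringer n (t + 1) j - ∑ j ∈ range k, entringer n (t + 1) j

lemma entringer_add_two (n t k : ℕ) : entringer n (t + 2) k = entringer n t k := by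
  induction n generalizing t k with
  | zero => rfl
  | succ n ih => simp [entringer, ih, add_right_comm t 2 1, Nat.even_add]

lemma entringer_add_two_mul (n t k i : ℕ) : entringer n (t + 2 * i) k = entringer n t k := by
  induction i with
  | zero => rfl
  | succ i ih => rw [mul_add, ← add_assoc, mul_one, entringer_add_two, ih]

lemma entringer_even_zero {n t : ℕ} (ht : Even t) :
    entringer n t 0 = if n = 0 then 1 else 0 := by
  cases n <;> simp [entringer, ht]

lemma entringer_odd_diag {n t : ℕ} (ht : ¬ Even t) : entringer (n + 1) t (n + 1) = 0 := by
  simp [entringer, ht]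

lemma entringer_succ_right (n t k : ℕ) :
    entringer (n + 1) t (k + 1) =
      entringer (n + 1) t k + (if Even t then 1 else -1) * entringer n (t + 1) k := by
  by_cases ht : Even t <;> simp [entringer, ht, sum_range_succ]
  ring

lemma fwdDiff_iter_entringer (n j t : ℕ) :
    (fwdDiff 1)^[j] (entringer (n + j) t) =
      fun k => (∏ i ∈ range j, if Even (t + i) then (1 : ℤ) else -1) * entringer n (t + j) k := by
  induction j generalizing t with
  | zero => simp
  | succ j ih =>
    have h1 : fwdDiff 1 (entringer (n + (j + 1)) t) =
        (if Even t then (1 : ℤ) else -1) • entringer (n + j) (t + 1) := by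
      ext k
      simp only [fwdDiff, ← add_assoc, entringer_succ_right, Pi.smul_apply, smul_eq_mul]
      ring
    rw [Function.iterate_succ_apply, h1, fwdDiff_iter_const_smul, ih]
    ext k
    rw [prod_range_succ']
    simp only [Pi.smul_apply, smul_eq_mul, add_assoc, add_comm 1, add_zero]
    ring

lemma entringer_diag (n t : ℕ) :
    entringer n t n = ∑ j ∈ range (n + 1), (n.choose j : ℤ) *
      ((∏ i ∈ range j, if Even (t + i) then (1 : ℤ) else -1) * entringer (n - j) (t + j) 0) := by
  have h := shift_eq_sum_fwdDiff_iter 1 (entringer n t) n 0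
  simp only [smul_eq_mul, mul_one, zero_add] at h
  rw [h]
  refine sum_congr rfl fun j hj => ?_
  have hj' : j ≤ n := by simpa [Nat.lt_succ_iff] using hj
  have := congrFun (fwdDiff_iter_entringer (n - j) j t) 0
  rw [Nat.sub_add_cancel hj'] at this
  rw [this, nsmul_eq_mul]

lemma prod_sign_even (i : ℕ) :
    ∏ l ∈ range (2 * i), (if Even (1 + l) then (1 : ℤ) else -1) = (-1) ^ i := by
  induction i with
  | zero => simp
  | succ i ih =>
    rw [mul_add, mul_one, prod_range_succ, prod_range_succ, ih, pow_succ]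
    simp [Nat.even_add]

lemma prod_sign_odd (i : ℕ) :
    ∏ l ∈ range (2 * i + 1), (if Even (1 + l) then (1 : ℤ) else -1) = -(-1) ^ i := by
  rw [prod_range_succ, prod_sign_even]
  simp [Nat.even_add]

lemma sum_range_two_mul {M : Type*} [AddCommMonoid M] (f : ℕ → M) (m : ℕ) :
    ∑ i ∈ range (2 * m), f i = ∑ i ∈ range m, f (2 * i) + ∑ i ∈ range m, f (2 * i + 1) := by
  induction m with
  | zero => simp
  | succ m ih =>
    rw [mul_add, mul_one, sum_range_succ, sum_range_succ, ih, sum_range_succ, sum_range_succ]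
    abel

lemma sum_choose_mul_entringer (n : ℕ) :
    ∑ i ∈ range (n + 1), ((2 * n + 1).choose (2 * i) : ℤ) *
      ((-1) ^ i * entringer (2 * (n - i) + 1) 1 0) = (-1) ^ n := by
  have h := entringer_diag (2 * n + 1) 1
  rw [entringer_odd_diag (by simp), show 2 * n + 1 + 1 = 2 * (n + 1) by ring,
    sum_range_two_mul] at h
  have hodd : ∑ i ∈ range (n + 1), ((2 * n + 1).choose (2 * i + 1) : ℤ) *
      ((∏ l ∈ range (2 * i + 1), if Even (1 + l) then (1 : ℤ) else -1) *
        entringer (2 * n + 1 - (2 * i + 1)) (1 + (2 * i + 1)) 0) = -(-1) ^ n := by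
    rw [sum_range_succ, sum_eq_zero, zero_add]
    · simp [prod_sign_odd, entringer]
    · intro i hi
      have hi' : i < n := by simpa using hi
      rw [entringer_even_zero (by simp [Nat.even_add]), if_neg (by omega)]
      simp
  rw [hodd] at h
  rw [← sub_eq_zero, sub_eq_add_neg, h]
  congr 1
  refine sum_congr rfl fun i hi => ?_
  have hi' : i ≤ n := by simpa [Nat.lt_succ_iff] using hi
  rw [prod_sign_even, entringer_add_two_mul, show 2 * n + 1 - 2 * i = 2 * (n - i) + 1 by omega]

lemma sum_cos_mul_entringer (n : ℕ) :
    ∑ i ∈ range (n + 1), (-1) ^ i / (2 * i).factorial *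
      ((entringer (2 * (n - i) + 1) 1 0 : ℚ) / (2 * (n - i) + 1).factorial) =
      (-1) ^ n / (2 * n + 1).factorial := by
  have h := congrArg (Int.cast (R := ℚ)) (sum_choose_mul_entringer n)
  push_cast at h
  rw [← h, sum_div]
  refine sum_congr rfl fun i hi => ?_
  have hi' : i ≤ n := by simpa [Nat.lt_succ_iff] using hi
  have h0 := Nat.cast_ne_zero (R := ℚ) |>.2 (2 * n + 1).factorial_ne_zero
  rw [Nat.cast_choose ℚ (by omega : 2 * i ≤ 2 * n + 1),
    show 2 * n + 1 - 2 * i = 2 * (n - i) + 1 by omega]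
  field_simp

end Entringer

lemma pathWeight_eq_entringer (n : ℕ) :
    pathWeight (2 * n) 0 = (entringer (2 * n + 1) 1 0 : ℚ) / (2 * n + 1).factorial := by
  induction n using Nat.strong_induction_on with
  | _ n ih =>
    have h := (sum_cos_mul_pathWeight n).trans (sum_cos_mul_entringer n).symm
    rw [sum_range_succ', sum_range_succ', sum_congr rfl (g := fun i =>
      (-1 : ℚ) ^ (i + 1) / (2 * (i + 1)).factorial *
        ((entringer (2 * (n - (i + 1)) + 1) 1 0 : ℚ) / (2 * (n - (i + 1)) + 1).factorial))] at h
    · simpa using h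
    · intro i hi
      have hi' : i < n := by simpa using hi
      rw [ih (n - (i + 1)) (by omega)]

section AlternatingPermutations

/-- The permutation with first entry `p`, the remaining entries being
order-isomorphic to `τ`. -/
def permCons {n : ℕ} (p : Fin (n + 1)) (τ : Equiv.Perm (Fin n)) : Equiv.Perm (Fin (n + 1)) :=
  (finSuccEquiv' 0).trans ((Equiv.optionCongr τ).trans (finSuccEquiv' p).symm)

@[simp]
lemma permCons_zero {n : ℕ} (p : Fin (n + 1)) (τ : Equiv.Perm (Fin n)) :
    permCons p τ 0 = p := by
  simp [permCons]

@[simp]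
lemma permCons_succ {n : ℕ} (p : Fin (n + 1)) (τ : Equiv.Perm (Fin n)) (i : Fin n) :
    permCons p τ i.succ = p.succAbove (τ i) := by
  have h : finSuccEquiv' (0 : Fin (n + 1)) i.succ = some i := by
    simp
  simp [permCons, h]

lemma permCons_injective {n : ℕ} :
    Function.Injective fun x : Fin (n + 1) × Equiv.Perm (Fin n) => permCons x.1 x.2 := by
  rintro ⟨p, τ⟩ ⟨q, ρ⟩ h
  have hp : p = q := by simpa using DFunLike.congr_fun h 0
  subst hp
  refine Prod.ext rfl (Equiv.ext fun i => ?_)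
  simpa using DFunLike.congr_fun h i.succ

lemma permCons_surjective {n : ℕ} :
    Function.Surjective fun x : Fin (n + 1) × Equiv.Perm (Fin n) => permCons x.1 x.2 := by
  refine ((Fintype.bijective_iff_injective_and_card _).2 ⟨permCons_injective, ?_⟩).2
  simp [Fintype.card_perm, Nat.factorial_succ]

/-- Alternation with the parity of the descents shifted by `t`. -/
def IsAltShift {n : ℕ} (t : ℕ) (σ : Equiv.Perm (Fin n)) : Prop :=
  ∀ i : ℕ, (h : i + 1 < n) → (σ ⟨i + 1, h⟩ < σ ⟨i, Nat.lt_of_succ_lt h⟩ ↔ Even (i + t))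

lemma isAltShift_permCons {n t : ℕ} (p : Fin (n + 2)) (τ : Equiv.Perm (Fin (n + 1))) :
    IsAltShift t (permCons p τ) ↔ ((τ 0).castSucc < p ↔ Even t) ∧ IsAltShift (t + 1) τ := by
  have h0 : p.succAbove (τ 0) < p ↔ (τ 0).castSucc < p := Fin.succAbove_lt_iff_castSucc_lt p (τ 0)
  have hs : ∀ (i : ℕ) (h : i + 1 < n + 2),
      permCons p τ ⟨i + 1, h⟩ = p.succAbove (τ ⟨i, Nat.lt_of_succ_lt_succ h⟩) :=
    fun i h => permCons_succ p τ ⟨i, Nat.lt_of_succ_lt_succ h⟩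
  have hz : ∀ h : 0 < n + 2, permCons p τ ⟨0, h⟩ = p := fun _ => permCons_zero p τ
  constructor
  · intro H
    refine ⟨?_, fun i h => ?_⟩
    · have := H 0 (by omega)
      rw [hs, hz] at this
      simpa [h0] using this
    · have := H (i + 1) (by omega)
      rw [hs, hs, Fin.succAbove_lt_succAbove_iff] at this
      rw [this, add_assoc, add_comm 1]
  · rintro ⟨H0, H⟩ i h
    cases i with
    | zero =>
      rw [hs, hz]
      simpa [h0] using H0
    | succ i =>
      rw [hs, hs, Fin.succAbove_lt_succAbove_iff, H i (by omega), add_assoc, add_comm 1]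

lemma card_isAltShift_succ {n t : ℕ} (p : Fin (n + 2)) :
    #{σ : Equiv.Perm (Fin (n + 2)) | IsAltShift t σ ∧ σ 0 = p} =
      ∑ j : Fin (n + 1) with (j.castSucc < p ↔ Even t),
        #{τ : Equiv.Perm (Fin (n + 1)) | IsAltShift (t + 1) τ ∧ τ 0 = j} := by
  have h1 : ({σ : Equiv.Perm (Fin (n + 2)) | IsAltShift t σ ∧ σ 0 = p} : Finset _) =
      ({τ : Equiv.Perm (Fin (n + 1)) |
        ((τ 0).castSucc < p ↔ Even t) ∧ IsAltShift (t + 1) τ} : Finset _).image (permCons p) := by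
    ext σ
    simp only [mem_filter, mem_univ, true_and, mem_image]
    constructor
    · rintro ⟨hσ, h0⟩
      obtain ⟨⟨q, τ⟩, rfl⟩ := permCons_surjective σ
      obtain rfl : q = p := by simpa using h0
      exact ⟨τ, (isAltShift_permCons _ _).1 hσ, rfl⟩
    · rintro ⟨τ, hτ, rfl⟩
      exact ⟨(isAltShift_permCons _ _).2 hτ, permCons_zero _ _⟩
  have hinj : Function.Injective (permCons p) := fun τ ρ h =>
    (Prod.ext_iff.1 (permCons_injective (a₁ := (p, τ)) (a₂ := (p, ρ)) h)).2
  rw [h1, card_image_of_injective _ hinj,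
    card_eq_sum_card_fiberwise (f := fun τ : Equiv.Perm (Fin (n + 1)) => τ 0)
      (t := ({j : Fin (n + 1) | j.castSucc < p ↔ Even t} : Finset _))]
  · refine sum_congr rfl fun j hj => congrArg card ?_
    ext τ
    simp only [mem_filter, mem_univ, true_and] at hj ⊢
    constructor
    · rintro ⟨⟨-, h⟩, h'⟩
      exact ⟨h, h'⟩
    · rintro ⟨h, rfl⟩
      exact ⟨⟨hj, h⟩, rfl⟩
  · intro τ hτ
    simp only [coe_filter, mem_univ, true_and, Set.mem_ofPred_eq] at hτ ⊢
    exact hτ.1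

lemma card_isAltShift_eq_entringer (n t : ℕ) (p : Fin (n + 1)) :
    (#{σ : Equiv.Perm (Fin (n + 1)) | IsAltShift t σ ∧ σ 0 = p} : ℤ) = entringer n t p := by
  induction n generalizing t with
  | zero =>
    have : ∀ σ : Equiv.Perm (Fin (0 + 1)), IsAltShift t σ ∧ σ 0 = p := fun σ =>
      ⟨fun i h => absurd h (by omega), Subsingleton.elim (α := Fin 1) _ _⟩
    simp [this, entringer]
  | succ n ih =>
    rw [card_isAltShift_succ]
    push_cast
    simp only [ih]
    have hlt : ∑ j : Fin (n + 1) with j.castSucc < p, entringer n (t + 1) j =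
        ∑ j ∈ range p, entringer n (t + 1) j := by
      rw [sum_filter]
      refine Eq.trans (sum_congr rfl fun j _ => ?_) ((Fin.sum_univ_eq_sum_range
        (fun j => if j < (p : ℕ) then entringer n (t + 1) j else 0) (n + 1)).trans ?_)
      · exact if_congr Iff.rfl rfl rfl
      rw [← sum_filter]
      congr 1
      ext j
      simp only [mem_filter, mem_range]
      have := p.isLt
      omega
    by_cases ht : Even t
    · simpa [entringer, ht] using hlt
    · simp only [entringer, ht, iff_false, if_false]
      rw [← hlt, ← Fin.sum_univ_eq_sum_range, eq_sub_iff_add_eq', sum_filter_add_sum_filter_not]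

lemma card_isAlt_eq_entringer (n : ℕ) :
    (#{σ : Equiv.Perm (Fin (n + 1)) | IsAlt σ} : ℤ) = entringer (n + 1) 1 0 := by
  have h : #{σ : Equiv.Perm (Fin (n + 1)) | IsAlt σ} =
      ∑ p : Fin (n + 1), #{σ : Equiv.Perm (Fin (n + 1)) | IsAltShift 0 σ ∧ σ 0 = p} := by
    rw [card_eq_sum_card_fiberwise (f := fun σ : Equiv.Perm (Fin (n + 1)) => σ 0) (t := univ)
      (fun _ _ => mem_coe.2 (mem_univ _))]
    simp only [filter_filter]
    rfl
  rw [h]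
  push_cast
  simp only [card_isAltShift_eq_entringer]
  rw [Fin.sum_univ_eq_sum_range (fun j => entringer n 0 j)]
  simp [entringer, entringer_add_two n 0]

end AlternatingPermutations

/-- `Σ_{Dyck paths of length 2n} (2n+1)! / ∏_{i=0}^{2n} (2h_i+1) = E_{2n+1}`,
the number of alternating permutations of `{1,…,2n+1}`. -/
theorem dyck_weighted_sum_eq_tangent (n : ℕ) :
    ∑ s ∈ dyckPaths n,
        ((2 * n + 1).factorial : ℚ) /
          ∏ i ∈ Finset.range (2 * n + 1), ((2 * pathHeight s i + 1 : ℤ) : ℚ) =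
    ((Finset.univ.filter fun σ : Equiv.Perm (Fin (2 * n + 1)) => IsAlt σ).card : ℚ) := by
  have hsum : ∑ s ∈ dyckPaths n, ((2 * n + 1).factorial : ℚ) /
      ∏ i ∈ Finset.range (2 * n + 1), ((2 * pathHeight s i + 1 : ℤ) : ℚ) =
      (2 * n + 1).factorial * pathWeight (2 * n) 0 := by
    rw [pathWeight, dyckPaths, sum_filter, mul_sum]
    refine sum_congr rfl fun s _ => ?_
    simp only [zero_add, mul_ite, mul_zero, div_eq_mul_inv]
  rw [hsum, pathWeight_eq_entringer,
    mul_div_cancel₀ _ (Nat.cast_ne_zero.2 (Nat.factorial_ne_zero _)), ← card_isAlt_eq_entringer]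
  norm_cast
end

section
/- For k ≥ 2 and 0 < r ≤ k, the generating function identity Σ_{n≥0} |A_k(nk+r)| t^{nk+r}/(nk+r)! = (Σ_{n≥0} (−1)^n t^{nk+r}/(nk+r)!) / (Σ_{n≥0} (−1)^n t^{nk}/(nk)!) holds as an identity of formal power series in t. -/
attribute [local instance] Classical.propDecidable

/-- `σ` is an alternating `k`-permutation: its (1-indexed) descent set is exactly the set
of multiples of `k` in `{1,…,m-1}`, i.e. `{k, 2k, …, (⌈m/k⌉-1)k}`. -/
def IsKAlt (k : ℕ) {m : ℕ} (σ : Equiv.Perm (Fin m)) : Prop :=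
  ∀ i : ℕ, (h : i + 1 < m) →
    (σ ⟨i + 1, h⟩ < σ ⟨i, Nat.lt_of_succ_lt h⟩ ↔ (i + 1) % k = 0)

/-- `|A_k(m)|`: the number of alternating `k`-permutations of `{1,…,m}`. -/
noncomputable def cardKAlt (k m : ℕ) : ℕ :=
  (Finset.univ.filter fun σ : Equiv.Perm (Fin m) => IsKAlt k σ).card

/-- The exponential generating function `Σ_{n≥0} |A_k(nk+r)| t^{nk+r}/(nk+r)!`. -/
noncomputable def Fgen (k r : ℕ) : PowerSeries ℚ :=
  PowerSeries.mk fun m =>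
    if r ≤ m ∧ (m - r) % k = 0 then (cardKAlt k m : ℚ) / (m.factorial : ℚ) else 0

/-- `Σ_{n≥0} (-1)^n t^{nk+r}/(nk+r)!`. -/
noncomputable def numer (k r : ℕ) : PowerSeries ℚ :=
  PowerSeries.mk fun m =>
    if r ≤ m ∧ (m - r) % k = 0 then ((-1 : ℚ)) ^ ((m - r) / k) / (m.factorial : ℚ) else 0

/-- `Σ_{n≥0} (-1)^n t^{nk}/(nk)!`. -/
noncomputable def denom (k : ℕ) : PowerSeries ℚ :=
  PowerSeries.mk fun m =>
    if m % k = 0 then ((-1 : ℚ)) ^ (m / k) / (m.factorial : ℚ) else 0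

open Finset in
/-- Permutations of `Fin (a + b)` that increase on the first `a` positions and restrict to a
pattern with prescribed descents on the last `b` positions: choose the values on the first `a`
positions, then arrange the remaining ones. -/
theorem card_increasing_then_isKAlt (k a b : ℕ) :
    (univ.filter fun σ : Equiv.Perm (Fin (a + b)) =>
      (∀ i : Fin a, ∀ j : Fin a, i < j → σ (Fin.castAdd b i) < σ (Fin.castAdd b j)) ∧
      ∀ i : ℕ, (h : i + 1 < b) →
        (σ (Fin.natAdd a ⟨i + 1, h⟩) < σ (Fin.natAdd a ⟨i, Nat.lt_of_succ_lt h⟩) ↔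
          (i + 1) % k = 0)).card = (a + b).choose a * cardKAlt k b := by
  have hc : ∀ S : {S : Finset (Fin (a + b)) // S.card = a}, (S.1)ᶜ.card = b := fun S => by
    rw [card_compl, S.2, Fintype.card_fin, Nat.add_sub_cancel_left]
  let e : {S : Finset (Fin (a + b)) // S.card = a} → Fin a ⊕ Fin b ≃ Fin (a + b) :=
    fun S => finSumEquivOfFinset S.2 (hc S)
  have e_inl : ∀ S i, e S (Sum.inl i) = S.1.orderEmbOfFin S.2 i := fun S i =>
    finSumEquivOfFinset_inl _ _ _
  have e_inr : ∀ S i, e S (Sum.inr i) = (S.1)ᶜ.orderEmbOfFin (hc S) i := fun S i =>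
    finSumEquivOfFinset_inr _ _ _
  let f : {S : Finset (Fin (a + b)) // S.card = a} × Equiv.Perm (Fin b) →
      Equiv.Perm (Fin (a + b)) := fun x =>
    finSumFinEquiv.symm.trans ((Equiv.sumCongr (Equiv.refl _) x.2).trans (e x.1))
  have f_left : ∀ x i, f x (Fin.castAdd b i) = x.1.1.orderEmbOfFin x.1.2 i := fun x i => by
    simp [f, e_inl]
  have f_right : ∀ x i, f x (Fin.natAdd a i) = (x.1.1)ᶜ.orderEmbOfFin (hc x.1) (x.2 i) :=
    fun x i => by simp [f, e_inr]
  have key : (univ.filter fun x : {S : Finset (Fin (a + b)) // S.card = a} ×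
      Equiv.Perm (Fin b) => IsKAlt k x.2).card = (a + b).choose a * cardKAlt k b := by
    have : (univ.filter fun x : {S : Finset (Fin (a + b)) // S.card = a} ×
        Equiv.Perm (Fin b) => IsKAlt k x.2) =
        univ ×ˢ univ.filter fun τ : Equiv.Perm (Fin b) => IsKAlt k τ := by
      ext x; simp
    rw [this, card_product, card_univ, Fintype.card_finset_len, Fintype.card_fin, cardKAlt]
  rw [← key]
  symm
  refine card_bij (fun x _ => f x) ?_ ?_ ?_
  · intro x hx
    simp only [mem_filter, mem_univ, true_and] at hx ⊢
    refine ⟨fun i j hij => ?_, fun i h => ?_⟩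
    · rw [f_left, f_left]
      exact (OrderEmbedding.lt_iff_lt _).2 hij
    · rw [f_right, f_right, OrderEmbedding.lt_iff_lt]
      exact hx i h
  · intro x _ y _ hxy
    have hS : x.1 = y.1 := by
      apply Subtype.ext
      have hx := range_orderEmbOfFin x.1.1 x.1.2
      have hy := range_orderEmbOfFin y.1.1 y.1.2
      apply coe_injective
      rw [← hx, ← hy]
      congr 1
      funext i
      rw [← f_left, ← f_left]
      exact congrArg (fun σ : Equiv.Perm (Fin (a + b)) => σ (Fin.castAdd b i)) hxy
    obtain ⟨S, τ⟩ := x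
    obtain ⟨S', τ'⟩ := y
    obtain rfl : S = S' := hS
    congr 1
    ext i : 1
    have := congrArg (fun σ : Equiv.Perm (Fin (a + b)) => σ (Fin.natAdd a i)) hxy
    simp only [f_right] at this
    exact (RelEmbedding.injective _) this
  · intro σ hσ
    simp only [mem_filter, mem_univ, true_and] at hσ
    obtain ⟨h1, h2⟩ := hσ
    let S : {S : Finset (Fin (a + b)) // S.card = a} :=
      ⟨univ.map ((Fin.castAddEmb b).trans σ.toEmbedding), by simp⟩
    have hleft : ∀ i, σ (Fin.castAdd b i) = S.1.orderEmbOfFin S.2 i := by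
      have := orderEmbOfFin_unique S.2 (f := fun i => σ (Fin.castAdd b i))
        (fun i => by simp [S]) (fun i j hij => h1 i j hij)
      exact fun i => congrFun this i
    have hmem : ∀ i, σ (Fin.natAdd a i) ∈ (S.1)ᶜ := by
      intro i
      simp only [S, mem_compl, mem_map, mem_univ, true_and, not_exists]
      intro j hj
      have := σ.injective hj
      have := congrArg Fin.val this
      simp at this
      omega
    let g : Fin b → Fin b := fun i => ((S.1)ᶜ.orderIsoOfFin (hc S)).symm ⟨_, hmem i⟩
    have hg : ∀ i, (S.1)ᶜ.orderEmbOfFin (hc S) (g i) = σ (Fin.natAdd a i) := fun i => by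
      rw [← coe_orderIsoOfFin_apply]
      simp [g]
    have ginj : Function.Injective g := fun i j hij => by
      have := congrArg ((S.1)ᶜ.orderEmbOfFin (hc S)) hij
      rw [hg, hg] at this
      simpa using σ.injective this
    let τ : Equiv.Perm (Fin b) := Equiv.ofBijective g (Finite.injective_iff_bijective.1 ginj)
    refine ⟨(S, τ), ?_, ?_⟩
    · simp only [mem_filter, mem_univ, true_and]
      intro i h
      rw [← h2 i h, ← hg, ← hg, OrderEmbedding.lt_iff_lt]
      rfl
    · ext i : 1
      refine Fin.addCases (fun i => ?_) (fun i => ?_) i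
      · rw [f_left, hleft]
      · rw [f_right, ← hg]
        rfl

/-- The number of permutations of `Fin m` whose (1-indexed) descents are exactly the
multiples of `k` that are at least `c`. -/
noncomputable def cardDescentsFrom (k c m : ℕ) : ℕ :=
  (Finset.univ.filter fun σ : Equiv.Perm (Fin m) => ∀ i : ℕ, (h : i + 1 < m) →
    (σ ⟨i + 1, h⟩ < σ ⟨i, Nat.lt_of_succ_lt h⟩ ↔ c ≤ i + 1 ∧ (i + 1) % k = 0)).card

theorem cardDescentsFrom_self (k m : ℕ) : cardDescentsFrom k k m = cardKAlt k m := by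
  unfold cardDescentsFrom cardKAlt IsKAlt
  congr! 5 with σ _ i h
  exact and_iff_right_of_imp fun hd => Nat.le_of_dvd i.succ_pos (Nat.dvd_of_mod_eq_zero hd)

theorem strictMono_of_forall_not_descent {m : ℕ} (σ : Equiv.Perm (Fin m)) (c : ℕ)
    (hσ : ∀ i : ℕ, (h : i + 1 < m) → i + 1 < c →
      ¬ σ ⟨i + 1, h⟩ < σ ⟨i, Nat.lt_of_succ_lt h⟩)
    (i j : ℕ) (hij : i < j) (hc : j < c) (hm : j < m) : σ ⟨i, hij.trans hm⟩ < σ ⟨j, hm⟩ := by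
  induction j with
  | zero => omega
  | succ j ih =>
    have hstep : σ ⟨j, Nat.lt_of_succ_lt hm⟩ < σ ⟨j + 1, hm⟩ := by
      refine lt_of_le_of_ne (not_lt.1 (hσ j hm hc)) fun he => ?_
      have := congrArg Fin.val (σ.injective he)
      simp at this
    rcases Nat.lt_succ_iff_lt_or_eq.1 hij with h | rfl
    · exact (ih h (by omega) (by omega)).trans hstep
    · exact hstep

theorem cardDescentsFrom_of_le {k c m : ℕ} (h : m ≤ c) : cardDescentsFrom k c m = 1 := by
  unfold cardDescentsFrom
  rw [Finset.card_eq_one]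
  refine ⟨1, ?_⟩
  ext σ
  simp only [Finset.mem_filter, Finset.mem_univ, true_and, Finset.mem_singleton]
  constructor
  · intro hσ
    have hmono : StrictMono σ := fun i j hij =>
      strictMono_of_forall_not_descent σ m
        (fun i hi _ hd => by have := (hσ i hi).1 hd; omega) i j hij j.2 j.2
    ext i : 1
    exact congrFun ((hmono.range_inj (g := id) strictMono_id).1 (by simp)) i
  · rintro rfl i hi
    simp only [Equiv.Perm.coe_one, id_eq, Fin.mk_lt_mk]
    omega

/-- Splitting the permutations counted by `card_increasing_then_isKAlt` according to whether
there is a descent at the junction. -/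
theorem choose_mul_cardKAlt {k j b : ℕ} (hk : 0 < k) (hj : 0 < j) (hb : 0 < b) :
    (j * k + b).choose (j * k) * cardKAlt k b =
      cardDescentsFrom k (j * k) (j * k + b) + cardDescentsFrom k ((j + 1) * k) (j * k + b) := by
  have ha : 0 < j * k := Nat.mul_pos hj hk
  have hnext : ∀ i, ((j + 1) * k ≤ i ∧ i % k = 0) ↔ (j * k < i ∧ i % k = 0) := by
    intro i
    refine and_congr_left fun hi => ?_
    obtain ⟨q, rfl⟩ := Nat.dvd_of_mod_eq_zero hi
    rw [mul_comm k q, Nat.mul_le_mul_right_iff hk, Nat.mul_lt_mul_right hk]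
    rfl
  rw [← card_increasing_then_isKAlt]
  unfold cardDescentsFrom
  rw [← Finset.card_union_of_disjoint]
  · congr 1
    ext σ
    simp only [Finset.mem_union, Finset.mem_filter, Finset.mem_univ, true_and, hnext]
    generalize hA : j * k = a at *
    have hmod : ∀ i, (a + i + 1) % k = (i + 1) % k := fun i => by
      rw [← hA, mul_comm, add_assoc, Nat.mul_add_mod]
    constructor
    · rintro ⟨h1, h2⟩
      have main : ∀ i : ℕ, (h : i + 1 < a + b) → i + 1 ≠ a →
          (σ ⟨i + 1, h⟩ < σ ⟨i, Nat.lt_of_succ_lt h⟩ ↔ a < i + 1 ∧ (i + 1) % k = 0) := by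
        intro i h hne
        rcases lt_or_gt_of_ne hne with hlt | hgt
        · have := h1 ⟨i, by omega⟩ ⟨i + 1, hlt⟩ (by simp)
          exact iff_of_false this.not_gt (by omega)
        · obtain ⟨t, rfl⟩ := Nat.exists_eq_add_of_le (Nat.lt_succ_iff.1 hgt)
          have := h2 t (by omega)
          rw [hmod]
          exact this.trans ⟨fun h => ⟨by omega, h⟩, fun h => h.2⟩
      by_cases hd : σ ⟨a, by omega⟩ < σ ⟨a - 1, by omega⟩
      · left
        intro i h
        by_cases hne : i + 1 = a
        · subst hne
          refine iff_of_true hd ⟨le_rfl, ?_⟩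
          rw [← hA, Nat.mul_mod_left]
        · rw [main i h hne]
          exact and_congr_left fun _ => by omega
      · right
        intro i h
        by_cases hne : i + 1 = a
        · subst hne
          exact iff_of_false hd (by omega)
        · exact main i h hne
    · intro hσ
      have main : ∀ i : ℕ, (h : i + 1 < a + b) → i + 1 ≠ a →
          (σ ⟨i + 1, h⟩ < σ ⟨i, Nat.lt_of_succ_lt h⟩ ↔ a < i + 1 ∧ (i + 1) % k = 0) := by
        intro i h hne
        rcases hσ with hσ | hσ
        · rw [hσ i h]
          exact and_congr_left fun _ => by omega
        · exact hσ i h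
      refine ⟨fun i l hil => ?_, fun i h => ?_⟩
      · exact strictMono_of_forall_not_descent σ a
          (fun i hi hlt hd => by have := (main i hi hlt.ne).1 hd; omega) i l hil l.2 (by omega)
      · have := main (a + i) (by omega) (by omega)
        rw [hmod] at this
        exact this.trans ⟨fun h => h.2, fun h => ⟨by omega, h⟩⟩
  · rw [Finset.disjoint_left]
    intro σ h1 h2
    simp only [Finset.mem_filter, Finset.mem_univ, true_and, hnext] at h1 h2
    have hi : j * k - 1 + 1 = j * k := by omega
    have h1 := h1 (j * k - 1) (by omega)
    have h2 := h2 (j * k - 1) (by omega)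
    rw [h1, hi] at h2
    simp at h2

theorem sum_neg_one_pow_choose_mul_cardKAlt {k r : ℕ} (hr : 0 < r) (hrk : r ≤ k) (n : ℕ) :
    ∑ j ∈ Finset.range (n + 1), (-1 : ℚ) ^ j *
      (((n * k + r).choose (j * k) : ℚ) * (cardKAlt k (n * k + r - j * k) : ℚ)) = (-1) ^ n := by
  have partial_sum : ∀ l ≤ n, ∑ j ∈ Finset.range (l + 1), (-1 : ℚ) ^ j *
      (((n * k + r).choose (j * k) : ℚ) * (cardKAlt k (n * k + r - j * k) : ℚ)) =
      (-1) ^ l * cardDescentsFrom k ((l + 1) * k) (n * k + r) := by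
    intro l
    induction l with
    | zero => intro _; simp [cardDescentsFrom_self]
    | succ l ih =>
      intro hl
      have hle : (l + 1) * k ≤ n * k := Nat.mul_le_mul_right k hl
      have h := choose_mul_cardKAlt (k := k) (j := l + 1) (b := n * k + r - (l + 1) * k)
        (by omega) l.succ_pos (by omega)
      rw [Nat.add_sub_cancel' (by omega)] at h
      rw [Finset.sum_range_succ, ih (by omega), ← Nat.cast_mul, h]
      push_cast
      ring
  rw [partial_sum n le_rfl, cardDescentsFrom_of_le (by rw [add_mul]; omega)]
  simp

theorem Fgen_mul_denom {k r : ℕ} (hr : 0 < r) (hrk : r ≤ k) :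
    Fgen k r * denom k = numer k r := by
  have hk : 0 < k := hr.trans_le hrk
  ext m
  rw [mul_comm, PowerSeries.coeff_mul]
  simp only [Fgen, denom, numer, PowerSeries.coeff_mk]
  rw [Finset.Nat.sum_antidiagonal_eq_sum_range_succ_mk]
  dsimp only
  by_cases hm : r ≤ m ∧ (m - r) % k = 0
  · rw [if_pos hm]
    obtain ⟨hrm, hmod⟩ := hm
    obtain ⟨n, hn⟩ := Nat.dvd_of_mod_eq_zero hmod
    obtain rfl : m = n * k + r := by rw [mul_comm]; omega
    have hdiv : (n * k + r - r) / k = n := by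
      rw [Nat.add_sub_cancel, Nat.mul_div_cancel _ hk]
    rw [hdiv, ← sum_neg_one_pow_choose_mul_cardKAlt hr hrk n, Finset.sum_div]
    symm
    refine Finset.sum_of_injOn (fun j => j * k)
      (fun x _ y _ h => Nat.eq_of_mul_eq_mul_right hk h) ?_ ?_ ?_
    · intro j hj
      simp only [Finset.coe_range, Set.mem_Iio] at hj ⊢
      have := Nat.mul_le_mul_right k (Nat.lt_succ_iff.1 hj)
      omega
    · intro q hq hq'
      by_cases h1 : q % k = 0
      · obtain ⟨j, rfl⟩ := Nat.dvd_of_mod_eq_zero h1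
        rw [if_neg (c := r ≤ _ ∧ _), mul_zero]
        rintro ⟨h2, -⟩
        refine hq' ⟨j, ?_, mul_comm _ _⟩
        simp only [Finset.mem_range] at hq
        have : j * k ≤ n * k := by rw [mul_comm j]; omega
        have := Nat.le_of_mul_le_mul_right this hk
        simp only [Finset.coe_range, Set.mem_Iio]
        omega
      · rw [if_neg h1, zero_mul]
    · intro j hj
      have hjn : j ≤ n := Nat.lt_succ_iff.1 (Finset.mem_range.1 hj)
      have hle := Nat.mul_le_mul_right k hjn
      have hsub : n * k + r - j * k - r = (n - j) * k := by rw [Nat.sub_mul]; omega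
      rw [if_pos (Nat.mul_mod_left _ _), if_pos ⟨by omega, by rw [hsub, Nat.mul_mod_left]⟩,
        Nat.mul_div_cancel _ hk, Nat.cast_choose ℚ (by omega : j * k ≤ n * k + r)]
      have h1 : ((n * k + r).factorial : ℚ) ≠ 0 := by positivity
      have h2 : ((j * k).factorial : ℚ) ≠ 0 := by positivity
      have h3 : ((n * k + r - j * k).factorial : ℚ) ≠ 0 := by positivity
      field_simp
  · rw [if_neg hm]
    refine Finset.sum_eq_zero fun q hq => ?_
    by_cases h1 : q % k = 0
    · rw [if_neg (c := r ≤ _ ∧ _), mul_zero]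
      rintro ⟨h2, h3⟩
      refine hm ⟨by omega, ?_⟩
      have : m - r = (m - q - r) + q := by omega
      rw [this, Nat.add_mod, h1, h3]
      simp
    · rw [if_neg h1, zero_mul]

/-- Kurşungöz–Yee: for `k ≥ 2` and `0 < r ≤ k`,
`Σ_{n≥0} |A_k(nk+r)| t^{nk+r}/(nk+r)! = (Σ_n (-1)^n t^{nk+r}/(nk+r)!)/(Σ_n (-1)^n t^{nk}/(nk)!)`. -/
theorem Fgen_eq_ratio (k r : ℕ) (hk : 2 ≤ k) (hr : 0 < r) (hrk : r ≤ k) :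
    Fgen k r = numer k r * (denom k)⁻¹ := by
  rw [PowerSeries.eq_mul_inv_iff_mul_eq]
  · exact Fgen_mul_denom hr hrk
  · simp [denom, ← PowerSeries.coeff_zero_eq_constantCoeff_apply]
end
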